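/- arXiv:2011.05953 — 2 statements merged into one kernel-verified Lean document; each statement's English description precedes it below -/
import Mathlib

section
/- Let S be a complete separable metric space, f ∈ F₁(a,b) with f*(y) < ∞ for all y ∈ ℝ, and P a Borel probability measure on S. Then for every c ∈ ℝ the sublevel set {Q a Borel probability measure on S : D_f(Q‖P) ≤ c} is compact in the topology of weak convergence of probability measures. -/
open MeasureTheory Filter Set Topology ENNReal
open scoped Classical

noncomputable section

/-- The set of bounded measurable real-valued functions on `Ω`. -/
def Mb (Ω : Type*) [MeasurableSpace Ω] : Set (Ω → ℝ) :=
  {g | Measurable g ∧ ∃ C : ℝ, ∀ x, |g x| ≤ C}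

/-- The set of bounded continuous real-valued functions on `S`. -/
def Cb (S : Type*) [TopologicalSpace S] : Set (S → ℝ) :=
  {g | Continuous g ∧ ∃ C : ℝ, ∀ x, |g x| ≤ C}

/-- The positive part of an extended real number, as an element of `ℝ≥0∞`. -/
def posE (x : EReal) : ℝ≥0∞ := if x = ⊤ then ⊤ else ENNReal.ofReal x.toReal

/-- The extended-real-valued integral of an `EReal`-valued function, defined as the
difference of the lower integrals of the positive and negative parts, with the
convention `∞ - ∞ = -∞`. -/
def eIntegral {Ω : Type*} [MeasurableSpace Ω] (P : Measure Ω) (h : Ω → EReal) : EReal :=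
  ((∫⁻ x, posE (h x) ∂P : ℝ≥0∞) : EReal) - ((∫⁻ x, posE (-(h x)) ∂P : ℝ≥0∞) : EReal)

/-- The Legendre transform `f*(y) = sup_x {x*y - f(x)}` of `f : ℝ → (-∞,∞]`. -/
def fstar (f : ℝ → EReal) (y : ℝ) : EReal := ⨆ x : ℝ, (((x * y : ℝ) : EReal) - f x)

/-- `f : ℝ → (-∞,∞]` is (the convex LSC extension of) an element of `F₁(a,b)`:
convex, lower semicontinuous, never `-∞`, finite exactly on the interval `(a,b)`
(with `+∞` strictly outside `[a,b]`), and `f(1) = 0` with `a < 1 < b`. -/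
structure IsF1 (a b : EReal) (f : ℝ → EReal) : Prop where
  a_lt_one : a < ((1 : ℝ) : EReal)
  one_lt_b : ((1 : ℝ) : EReal) < b
  convex : ∀ x y t : ℝ, 0 < t → t < 1 →
    f (t * x + (1 - t) * y) ≤ ((t : ℝ) : EReal) * f x + (((1 - t : ℝ)) : EReal) * f y
  lsc : LowerSemicontinuous f
  ne_bot : ∀ x, f x ≠ ⊥
  finite_on : ∀ x : ℝ, a < (x : EReal) → (x : EReal) < b → f x ≠ ⊤
  top_outside : ∀ x : ℝ, ((x : EReal) < a ∨ b < (x : EReal)) → f x = ⊤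
  at_one : f 1 = 0

/-- `Λ_f^P[g] = inf_{ν ∈ ℝ} {ν + E_P[f*(g - ν)]}`. -/
def LambdaF {Ω : Type*} [MeasurableSpace Ω] (f : ℝ → EReal) (P : Measure Ω) (g : Ω → ℝ) :
    EReal :=
  ⨅ ν : ℝ, ((ν : EReal) + eIntegral P (fun x => fstar f (g x - ν)))

/-- The classical `f`-divergence `D_f(Q‖P) = E_P[f(dQ/dP)]` if `Q ≪ P`, else `∞`. -/
def fDivE {Ω : Type*} [MeasurableSpace Ω] (f : ℝ → EReal) (Q P : Measure Ω) : EReal :=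
  if Q ≪ P then eIntegral P (fun x => f ((Q.rnDeriv P x).toReal)) else ⊤

/-- The `(f,Γ)`-divergence `D_f^Γ(Q‖P) = sup_{g ∈ Γ} {E_Q[g] - Λ_f^P[g]}`. -/
def fGammaDiv {Ω : Type*} [MeasurableSpace Ω] (f : ℝ → EReal) (Γ : Set (Ω → ℝ))
    (Q P : Measure Ω) : EReal :=
  ⨆ g ∈ Γ, (((∫ x, g x ∂Q : ℝ) : EReal) - LambdaF f P g)

/-- The `Γ`-IPM `W^Γ(Q,P) = sup_{g ∈ Γ} {E_Q[g] - E_P[g]}`. -/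
def ipmW {Ω : Type*} [MeasurableSpace Ω] (Γ : Set (Ω → ℝ)) (Q P : Measure Ω) : EReal :=
  ⨆ g ∈ Γ, (((∫ x, g x ∂Q : ℝ) : EReal) - ((∫ x, g x ∂P : ℝ) : EReal))

end

lemma aux_fstar_real {f : ℝ → EReal} (h1 : f 1 = 0) (hfin : ∀ y : ℝ, fstar f y ≠ ⊤) (y : ℝ) :
    ((fstar f y).toReal : EReal) = fstar f y := by
  apply EReal.coe_toReal (hfin y)
  have h : (((1 * y : ℝ) : EReal) - f 1) ≤ fstar f y :=
    le_iSup (fun x : ℝ => (((x * y : ℝ) : EReal) - f x)) 1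
  rw [h1, sub_zero] at h
  intro h2
  rw [h2] at h
  exact absurd h (by simp)

lemma aux_minor {f : ℝ → EReal} (h1 : f 1 = 0) (hb : ∀ x, f x ≠ ⊥)
    (hfin : ∀ y : ℝ, fstar f y ≠ ⊤) (x y : ℝ) :
    ((x * y - (fstar f y).toReal : ℝ) : EReal) ≤ f x := by
  have h : (((x * y : ℝ) : EReal) - f x) ≤ fstar f y :=
    le_iSup (fun x : ℝ => (((x * y : ℝ) : EReal) - f x)) x
  rw [← aux_fstar_real h1 hfin y] at h
  generalize (fstar f y).toReal = g at *
  have hx := hb x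
  generalize f x = z at *
  induction z with
  | bot => exact absurd rfl hx
  | top => exact le_top
  | coe r =>
    norm_cast at h ⊢
    linarith

lemma aux_fstar_le {f : ℝ → EReal} (h1 : f 1 = 0)
    (hfin : ∀ y : ℝ, fstar f y ≠ ⊤) (α β : ℝ) (h : ∀ x : ℝ, ((α * x + β : ℝ) : EReal) ≤ f x) :
    (fstar f α).toReal ≤ - β := by
  have : fstar f α ≤ ((-β : ℝ) : EReal) := by
    refine iSup_le fun x => ?_
    have hx := h x
    generalize f x = z at *
    induction z with
    | bot => exact absurd (le_bot_iff.1 hx) (EReal.coe_ne_bot _)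
    | top => simp
    | coe r =>
      norm_cast at hx ⊢
      linarith
  rw [← aux_fstar_real h1 hfin] at this
  exact_mod_cast this

lemma aux_dual {a b : EReal} {f : ℝ → EReal} (hf : IsF1 a b f)
    (hfin : ∀ y : ℝ, fstar f y ≠ ⊤) (x0 r : ℝ) (hr : (r : EReal) < f x0) :
    ∃ y : ℝ, r < x0 * y - (fstar f y).toReal := by
  let E : Set (ℝ × ℝ) := {p | f p.1 ≤ (p.2 : EReal)}
  have hEc : IsClosed E := by
    have := hf.lsc.isClosed_epigraph
    have hc : Continuous (fun p : ℝ × ℝ => ((p.1, (p.2 : EReal)) : ℝ × EReal)) := by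
      exact continuous_fst.prodMk (continuous_coe_real_ereal.comp continuous_snd)
    exact this.preimage hc
  have hEx : Convex ℝ E := by
    rw [convex_iff_forall_pos]
    rintro ⟨x1, t1⟩ h1 ⟨x2, t2⟩ h2 s t hs ht hst
    have ht' : t = 1 - s := by linarith
    subst ht'
    simp only [E, mem_ofPred_eq] at h1 h2
    change f (s * x1 + (1 - s) * x2) ≤ ((s * t1 + (1 - s) * t2 : ℝ) : EReal)
    refine (hf.convex x1 x2 s hs (by linarith)).trans ?_
    rw [EReal.coe_add, EReal.coe_mul, EReal.coe_mul]
    gcongr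
  have hnot : (x0, r) ∉ E := by
    simp only [E, mem_ofPred_eq, not_le]
    exact hr
  obtain ⟨φ, s, hφ0, hφ⟩ := geometric_hahn_banach_point_closed hEx hEc hnot
  set u := φ (1, 0) with hu
  set v := φ (0, 1) with hv
  have hφe : ∀ x t : ℝ, φ (x, t) = u * x + v * t := by
    intro x t
    have : ((x, t) : ℝ × ℝ) = x • (1, 0) + t • (0, 1) := by ext <;> simp
    rw [this, map_add, map_smul, map_smul]
    simp only [smul_eq_mul, ← hu, ← hv]; ring
  rw [hφe] at hφ0
  have hφ' : ∀ x t : ℝ, f x ≤ (t : EReal) → s < u * x + v * t := by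
    intro x t h
    rw [← hφe]; exact hφ (x, t) h
  have hv0 : 0 ≤ v := by
    by_contra hneg
    push Not at hneg
    have h1 := hφ' 1 (max 0 ((s - u) / v)) (by rw [hf.at_one]; exact_mod_cast le_max_left _ _)
    have h2 : (s - u) / v ≤ max 0 ((s - u) / v) := le_max_right _ _
    have h3 := mul_le_mul_of_nonpos_left h2 hneg.le
    rw [mul_div_cancel₀ _ hneg.ne] at h3
    linarith
  rcases hv0.eq_or_lt with hv0 | hv0
  · -- vertical
    rw [← hv0] at hφ0 hφ'
    simp only [zero_mul, add_zero] at hφ0 hφ'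
    set M := (fstar f 0).toReal with hM
    have hmin := fun x => aux_minor hf.at_one hf.ne_bot hfin x 0
    obtain ⟨l, hl0, hl⟩ : ∃ l : ℝ, 0 ≤ l ∧ r + M < l * (s - u * x0) := by
      have hd : 0 < s - u * x0 := by linarith
      refine ⟨(|r + M| + 1) / (s - u * x0), by positivity, ?_⟩
      rw [div_mul_cancel₀ _ hd.ne']
      linarith [le_abs_self (r + M)]
    refine ⟨-(l * u), ?_⟩
    have := aux_fstar_le hf.at_one hfin (-(l * u)) (l * s - M) (by
      intro x
      have h1 := hmin x
      have h2 := hφ' x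
      generalize f x = z at *
      induction z with
      | bot => exact absurd h1 (by simp only [le_bot_iff]; exact EReal.coe_ne_bot _)
      | top => exact le_top
      | coe w =>
        have h3 := h2 w le_rfl
        norm_cast at h1 ⊢
        nlinarith)
    nlinarith
  · refine ⟨-(u / v), ?_⟩
    have := aux_fstar_le hf.at_one hfin (-(u / v)) (s / v) (by
      intro x
      have h1 := hf.ne_bot x
      have h2 := hφ' x
      generalize f x = z at *
      induction z with
      | bot => exact absurd rfl h1
      | top => exact le_top
      | coe w =>
        have h3 := h2 w le_rfl
        norm_cast
        have : -(u / v) * x + s / v = (s - u * x) / v := by field_simp; ring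
        rw [this, div_le_iff₀ hv0]
        linarith)
    have h4 : r < (s - u * x0) / v := by
      rw [lt_div_iff₀ hv0]; linarith
    have : -(u / v) * x0 + s / v = (s - u * x0) / v := by field_simp; ring
    linarith

lemma aux_posE_coe (r : ℝ) : posE (r : EReal) = ENNReal.ofReal r := by
  simp [posE]

lemma aux_posE_top : posE ⊤ = ⊤ := by simp [posE]

lemma aux_key {a b : EReal} {f : ℝ → EReal} (hf : IsF1 a b f)
    (hfin : ∀ y : ℝ, fstar f y ≠ ⊤) :
    ∃ (M : ℝ) (y g : ℕ → ℝ), 0 ≤ M ∧ y 0 = 0 ∧ g 0 = 0 ∧ (∀ x, ((-M : ℝ) : EReal) ≤ f x) ∧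
      (∀ x, posE (f x + (M : EReal)) = ⨆ n, ENNReal.ofReal (x * y n - g n)) ∧
      ∀ Y : ℝ, ∃ G : ℝ, ∀ x, ENNReal.ofReal (x * Y) ≤ posE (f x + (M : EReal)) + ENNReal.ofReal G := by
  have hmin := aux_minor hf.at_one hf.ne_bot hfin
  set gs : ℝ → ℝ := fun y => (fstar f y).toReal with hgs
  have hminM : ∀ x, ((-(gs 0) : ℝ) : EReal) ≤ f x := by
    intro x; simpa using hmin x 0
  obtain ⟨T, hTc, hT⟩ := TopologicalSpace.isOpen_iUnion_countable
    (fun y : ℝ => {p : ℝ × ℝ | p.2 < p.1 * y - gs y})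
    (fun y => isOpen_lt continuous_snd (by fun_prop))
  have hTc' : (insert (0:ℝ) T).Countable := hTc.insert 0
  obtain ⟨e, he⟩ := hTc'.exists_eq_range ⟨0, mem_insert _ _⟩
  have hM0 : 0 ≤ gs 0 := by
    have := hminM 1
    rw [hf.at_one] at this
    have : -(gs 0) ≤ 0 := by exact_mod_cast this
    linarith
  have hmono : ∀ x y, ENNReal.ofReal (x * y - gs y + gs 0) ≤ posE (f x + (gs 0 : EReal)) := by
    intro x y
    have h := hmin x y
    have hb := hf.ne_bot x
    change ((x * y - gs y : ℝ) : EReal) ≤ f x at h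
    generalize f x = z at *
    induction z with
    | bot => exact absurd rfl hb
    | top => simp [aux_posE_top]
    | coe w =>
      rw [← EReal.coe_add, aux_posE_coe]
      norm_cast at h
      exact ENNReal.ofReal_le_ofReal (by linarith)
  let y : ℕ → ℝ := fun n => Nat.casesOn n 0 e
  refine ⟨gs 0, y, fun n => gs (y n) - gs 0, hM0, rfl, by simp [y], hminM, ?_, ?_⟩
  · intro x
    apply le_antisymm
    · refine ENNReal.le_of_forall_nnreal_lt fun r hr => ?_
      have hr' : (((r : ℝ) - gs 0 : ℝ) : EReal) < f x := by
        have hb := hf.ne_bot x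
        generalize f x = z at *
        induction z with
        | bot => exact absurd rfl hb
        | top => exact EReal.coe_lt_top _
        | coe w =>
          rw [← EReal.coe_add, aux_posE_coe, ← ENNReal.ofReal_coe_nnreal] at hr
          have := (ENNReal.ofReal_lt_ofReal_iff_of_nonneg r.2).1 hr
          norm_cast
          change (r : ℝ) < _ at this
          linarith
      obtain ⟨y1, hy1⟩ := aux_dual hf hfin _ _ hr'
      have : ((x, (r : ℝ) - gs 0) : ℝ × ℝ) ∈ ⋃ i ∈ T, {p : ℝ × ℝ | p.2 < p.1 * i - gs i} := by
        rw [hT]; exact mem_iUnion.2 ⟨y1, hy1⟩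
      simp only [mem_iUnion] at this
      obtain ⟨y2, hy2, h2⟩ := this
      have h2' : (r : ℝ) - gs 0 < x * y2 - gs y2 := h2
      obtain ⟨n, rfl⟩ : y2 ∈ range e := he ▸ mem_insert_of_mem _ hy2
      refine le_trans ?_ (le_iSup _ (n + 1))
      rw [← ENNReal.ofReal_coe_nnreal]
      apply ENNReal.ofReal_le_ofReal
      change (r : ℝ) ≤ x * e n - (gs (e n) - gs 0)
      linarith
    · refine iSup_le fun n => ?_
      have := hmono x (y n)
      rwa [show x * y n - gs (y n) + gs 0 = x * y n - (gs (y n) - gs 0) by ring] at this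
  · intro Y
    refine ⟨gs Y - gs 0, fun x => ?_⟩
    refine le_trans ?_ (add_le_add_left (hmono x Y) _)
    refine le_trans ?_ ENNReal.ofReal_add_le
    exact ENNReal.ofReal_le_ofReal (by linarith)

lemma aux_eIntegral {Ω : Type*} [MeasurableSpace Ω] (P : Measure Ω) [IsProbabilityMeasure P]
    (h : Ω → EReal) (hm : Measurable h) (M : ℝ) (hM : 0 ≤ M) (hb : ∀ x, ((-M : ℝ) : EReal) ≤ h x)
    (c : ℝ) :
    eIntegral P h ≤ (c : EReal) ↔
      0 ≤ c + M ∧ ∫⁻ x, posE (h x + (M : EReal)) ∂P ≤ ENNReal.ofReal (c + M) := by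
  have hpm : Measurable posE := by
    unfold posE
    exact Measurable.ite (measurableSet_singleton _) measurable_const
      (ENNReal.measurable_ofReal.comp measurable_ereal_toReal)
  have hpt : ∀ x, posE (h x + (M : EReal)) + posE (- h x) = posE (h x) + ENNReal.ofReal M := by
    intro x
    have hb := hb x
    generalize h x = z at *
    induction z with
    | bot => exact absurd hb (by simp only [le_bot_iff]; exact EReal.coe_ne_bot _)
    | top => simp [aux_posE_top]
    | coe w =>
      rw [← EReal.coe_add, ← EReal.coe_neg, aux_posE_coe, aux_posE_coe, aux_posE_coe]
      norm_cast at hb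
      rcases le_total 0 w with hw | hw
      · rw [ENNReal.ofReal_of_nonpos (by linarith : -w ≤ 0), add_zero, ENNReal.ofReal_add hw hM]
      · rw [ENNReal.ofReal_of_nonpos hw, zero_add, ← ENNReal.ofReal_add (by linarith) (by linarith)]
        congr 1; ring
  have hle : ∀ x, posE (- h x) ≤ ENNReal.ofReal M := by
    intro x
    have hb := hb x
    generalize h x = z at *
    induction z with
    | bot => exact absurd hb (by simp only [le_bot_iff]; exact EReal.coe_ne_bot _)
    | top => simp [posE]
    | coe w =>
      rw [← EReal.coe_neg, aux_posE_coe]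
      norm_cast at hb
      exact ENNReal.ofReal_le_ofReal (by linarith)
  have hint : ∫⁻ x, posE (h x + (M : EReal)) ∂P + ∫⁻ x, posE (- h x) ∂P
      = ∫⁻ x, posE (h x) ∂P + ENNReal.ofReal M := by
    rw [← lintegral_add_right _ (show Measurable (fun x => posE (- h x)) from hpm.comp hm.neg), lintegral_congr hpt,
      lintegral_add_right _ measurable_const]
    simp
  have hfin : ∫⁻ x, posE (- h x) ∂P ≠ ⊤ := by
    have : ∫⁻ x, posE (- h x) ∂P ≤ ∫⁻ x, ENNReal.ofReal M ∂P := lintegral_mono hle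
    refine ne_top_of_le_ne_top ?_ this
    simp
  unfold eIntegral
  generalize ∫⁻ x, posE (- h x) ∂P = B at *
  generalize ∫⁻ x, posE (h x) ∂P = A at *
  generalize ∫⁻ x, posE (h x + (M : EReal)) ∂P = D at *
  lift B to NNReal using hfin
  rcases eq_or_ne A ⊤ with rfl | hA
  · have : D = ⊤ := by
      by_contra hD
      lift D to NNReal using hD
      rw [top_add, ← ENNReal.coe_add] at hint
      exact ENNReal.coe_ne_top hint
    subst this
    simp only [EReal.coe_ennreal_top, top_le_iff, ENNReal.ofReal_ne_top, and_false, iff_false,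
      not_le]
    rw [show (((B : ENNReal) : EReal)) = ((B : ℝ) : EReal) from rfl, EReal.top_sub_coe]
    exact EReal.coe_lt_top _
  · lift A to NNReal using hA
    have hD : D ≠ ⊤ := by
      rintro rfl
      rw [top_add] at hint
      exact (ENNReal.add_ne_top.2 ⟨ENNReal.coe_ne_top, ENNReal.ofReal_ne_top⟩) hint.symm
    lift D to NNReal using hD
    have hr : (D : ℝ) + B = A + M := by
      have := congrArg ENNReal.toReal hint
      rw [ENNReal.toReal_add (by simp) (by simp), ENNReal.toReal_add (by simp) (by simp),
        ENNReal.toReal_ofReal hM] at this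
      simpa using this
    rw [show (((B : ENNReal) : EReal)) = ((B : ℝ) : EReal) from rfl,
      show (((A : ENNReal) : EReal)) = ((A : ℝ) : EReal) from rfl, ← EReal.coe_sub,
      EReal.coe_le_coe_iff]
    constructor
    · intro h
      have : (D : ℝ) ≤ c + M := by linarith
      refine ⟨D.2.trans this, ?_⟩
      rw [← ENNReal.ofReal_coe_nnreal]
      exact ENNReal.ofReal_le_ofReal this
    · rintro ⟨h0, h1⟩
      rw [← ENNReal.ofReal_coe_nnreal, ENNReal.ofReal_le_ofReal_iff h0] at h1
      linarith

lemma aux_uac {S : Type*} [MeasurableSpace S] (P : Measure S) [IsProbabilityMeasure P]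
    (F : ℝ → ℝ≥0∞)
    (hG : ∀ Y : ℝ, ∃ G : ℝ, ∀ x, ENNReal.ofReal (x * Y) ≤ F x + ENNReal.ofReal G) (C : ℝ)
    (ε : ℝ≥0∞) (hε : 0 < ε) :
    ∃ δ : ℝ≥0∞, 0 < δ ∧ ∀ Q : Measure S, IsProbabilityMeasure Q → Q ≪ P →
      ∫⁻ x, F (Q.rnDeriv P x).toReal ∂P ≤ ENNReal.ofReal C →
      ∀ A, MeasurableSet A → P A ≤ δ → Q A ≤ ε := by
  obtain ⟨e, he0, he⟩ := ENNReal.lt_iff_exists_nnreal_btwn.1 hε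
  have he0' : (0 : ℝ) < e := by exact_mod_cast he0
  set Y : ℝ := 2 * (|C| + 1) / e with hY
  have hYpos : 0 < Y := by positivity
  obtain ⟨G, hG⟩ := hG Y
  refine ⟨ENNReal.ofReal ((|C| + 1) / (|G| + 1)), by
    rw [ENNReal.ofReal_pos]; positivity, ?_⟩
  intro Q hQ hac hint A hA hPA
  refine le_trans ?_ he.le
  have h1 : ENNReal.ofReal Y * Q A ≤ ENNReal.ofReal C + ENNReal.ofReal G * P A := by
    calc ENNReal.ofReal Y * Q A
        = ∫⁻ x in A, ENNReal.ofReal Y * Q.rnDeriv P x ∂P := by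
          rw [lintegral_const_mul _ (Measure.measurable_rnDeriv _ _),
            Measure.setLIntegral_rnDeriv hac]
      _ = ∫⁻ x in A, ENNReal.ofReal ((Q.rnDeriv P x).toReal * Y) ∂P := by
          apply lintegral_congr_ae
          filter_upwards [ae_restrict_of_ae (Measure.rnDeriv_ne_top Q P)] with x hx
          rw [ENNReal.ofReal_mul ENNReal.toReal_nonneg, ENNReal.ofReal_toReal hx, mul_comm]
      _ ≤ ∫⁻ x in A, (F (Q.rnDeriv P x).toReal + ENNReal.ofReal G) ∂P :=
          lintegral_mono fun x => hG _
      _ = ∫⁻ x in A, F (Q.rnDeriv P x).toReal ∂P + ENNReal.ofReal G * P A := by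
          rw [lintegral_add_right _ measurable_const]; simp
      _ ≤ _ := by
          gcongr
          exact (setLIntegral_le_lintegral _ _).trans hint
  have h2 : ENNReal.ofReal C + ENNReal.ofReal G * P A ≤ ENNReal.ofReal Y * e := by
    calc ENNReal.ofReal C + ENNReal.ofReal G * P A
        ≤ ENNReal.ofReal (|C| + 1) + ENNReal.ofReal (|G| + 1) *
            ENNReal.ofReal ((|C| + 1) / (|G| + 1)) := by
          gcongr
          · linarith [le_abs_self C]
          · linarith [le_abs_self G]
      _ = ENNReal.ofReal Y * e := by
          rw [← ENNReal.ofReal_mul (by positivity), ← ENNReal.ofReal_add (by positivity)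
            (by positivity), ← ENNReal.ofReal_coe_nnreal, ← ENNReal.ofReal_mul hYpos.le]
          congr 1
          rw [hY]
          field_simp
          ring
  have h3 := h1.trans h2
  rwa [ENNReal.mul_le_mul_iff_right (by simpa using hYpos) ENNReal.ofReal_ne_top] at h3

lemma aux_setwise {S : Type*} [MetricSpace S] [MeasurableSpace S] [BorelSpace S]
    (P : Measure S) [IsProbabilityMeasure P] (Qs : ℕ → ProbabilityMeasure S)
    (Q : ProbabilityMeasure S) (hlim : Tendsto Qs atTop (𝓝 Q))
    (huac : ∀ ε : ℝ≥0∞, 0 < ε → ∃ δ : ℝ≥0∞, 0 < δ ∧ ∀ n, ∀ A, MeasurableSet A → P A ≤ δ →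
      (Qs n : Measure S) A ≤ ε) (A : Set S) (hA : MeasurableSet A) :
    Tendsto (fun n => (Qs n : Measure S) A) atTop (𝓝 ((Q : Measure S) A)) := by
  have key : ∀ A, MeasurableSet A →
      limsup (fun n => (Qs n : Measure S) A) atTop ≤ (Q : Measure S) A := by
    intro A hA
    refine ENNReal.le_of_forall_pos_le_add fun ε hε _ => ?_
    obtain ⟨δ, hδ, h⟩ := huac ε (by exact_mod_cast hε)
    obtain ⟨K, hKA, hKc, hK⟩ := hA.exists_isClosed_sdiff_lt (μ := P) (measure_ne_top _ _) hδ.ne'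
    calc limsup (fun n => (Qs n : Measure S) A) atTop
        ≤ limsup (fun n => (Qs n : Measure S) K + ε) atTop := by
          apply limsup_le_limsup (hu := isCobounded_le_of_bot) (hv := isBounded_le_of_top)
          refine Eventually.of_forall fun n => ?_
          have := h n _ (hA.diff hKc.measurableSet) hK.le
          calc (Qs n : Measure S) A ≤ (Qs n : Measure S) (K ∪ (A \ K)) :=
                measure_mono (by rw [union_sdiff_self]; exact subset_union_right)
            _ ≤ _ := (measure_union_le _ _).trans (add_le_add le_rfl this)
      _ ≤ limsup (fun n => (Qs n : Measure S) K) atTop + ε := by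
          exact (limsup_add_const atTop _ _ isBounded_le_of_top isCobounded_le_of_bot).le
      _ ≤ (Q : Measure S) K + ε := by
          gcongr
          exact ProbabilityMeasure.limsup_measure_closed_le_of_tendsto hlim hKc
      _ ≤ (Q : Measure S) A + ε := by gcongr
  exact tendsto_of_le_liminf_of_limsup_le
    (le_measure_liminf_of_limsup_measure_compl_le hA (key _ hA.compl)) (key _ hA)

lemma aux_argmax {S : Type*} [MeasurableSpace S] (φ : ℕ → S → ℝ) (hφ : ∀ n, Measurable (φ n))
    (k : ℕ) : ∃ N : S → ℕ, Measurable N ∧ (∀ x, N x ≤ k) ∧ ∀ x, ∀ i ≤ k, φ i x ≤ φ (N x) x := by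
  induction k with
  | zero =>
    refine ⟨fun _ => 0, measurable_const, fun _ => le_rfl, fun x i hi => ?_⟩
    rw [Nat.le_zero.1 hi]
  | succ k ih =>
    obtain ⟨N, hN, hNk, hmax⟩ := ih
    have hmeas : Measurable (fun x => φ (N x) x) := by
      have : Measurable (fun p : ℕ × S => φ p.1 p.2) := measurable_from_prod_countable_right hφ
      exact this.comp (hN.prodMk measurable_id)
    refine ⟨fun x => if φ (N x) x < φ (k + 1) x then k + 1 else N x,
      Measurable.ite (measurableSet_lt hmeas (hφ _)) measurable_const hN, ?_, ?_⟩
    · intro x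
      dsimp only
      split_ifs
      · exact le_rfl
      · exact (hNk x).trans (Nat.le_succ k)
    · intro x i hi
      dsimp only
      rcases Nat.le_succ_iff.1 hi with h | h
      · split_ifs with hlt
        · exact (hmax x i h).trans hlt.le
        · exact hmax x i h
      · subst h
        split_ifs with hlt
        · exact le_rfl
        · exact not_lt.1 hlt

/-- integral of a function of a bounded discrete variable -/
lemma aux_int_sum {S : Type*} [MeasurableSpace S] (Q : Measure S) [IsFiniteMeasure Q]
    (N : S → ℕ) (hN : Measurable N) (k : ℕ) (hk : ∀ x, N x ≤ k) (y : ℕ → ℝ) :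
    Integrable (fun x => y (N x)) Q ∧
    ∫ x, y (N x) ∂Q = ∑ i ∈ Finset.range (k + 1), (Q (N ⁻¹' {i})).toReal * y i := by
  have heq : (fun x => y (N x)) = fun x => ∑ i ∈ Finset.range (k + 1),
      (N ⁻¹' {i}).indicator (fun _ => y i) x := by
    funext x
    rw [Finset.sum_eq_single (N x)]
    · simp
    · intro j _ hj
      exact indicator_of_notMem (by simpa using fun h => hj h.symm) _
    · intro h
      exact absurd (Finset.mem_range.2 (Nat.lt_succ_of_le (hk x))) h
  have hm : ∀ i, MeasurableSet (N ⁻¹' {i}) := fun i => hN (measurableSet_singleton i)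
  have hi : ∀ i ∈ Finset.range (k + 1),
      Integrable ((N ⁻¹' {i}).indicator (fun _ => y i)) Q := fun i _ =>
    (integrable_const _).indicator (hm i)
  rw [heq]
  refine ⟨integrable_finsetSum _ hi, ?_⟩
  rw [integral_finsetSum _ hi]
  refine Finset.sum_congr rfl fun i _ => ?_
  rw [integral_indicator_const _ (hm i)]
  rfl

/-- the affine test integral -/
lemma aux_affine {S : Type*} [MeasurableSpace S] (P Q : Measure S) [IsProbabilityMeasure P]
    [IsProbabilityMeasure Q] (hac : Q ≪ P)
    (N : S → ℕ) (hN : Measurable N) (k : ℕ) (hk : ∀ x, N x ≤ k) (y g : ℕ → ℝ) :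
    Integrable (fun x => (Q.rnDeriv P x).toReal * y (N x) - g (N x)) P ∧
    ∫ x, ((Q.rnDeriv P x).toReal * y (N x) - g (N x)) ∂P =
      ∫ x, y (N x) ∂Q - ∫ x, g (N x) ∂P := by
  have h1 := (aux_int_sum Q N hN k hk y).1
  have h2 := (aux_int_sum P N hN k hk g).1
  have h3 : Integrable (fun x => (Q.rnDeriv P x).toReal * y (N x)) P :=
    (integrable_rnDeriv_smul_iff hac).2 h1
  refine ⟨h3.sub h2, ?_⟩
  rw [integral_sub h3 h2]
  congr 1
  exact integral_rnDeriv_smul hac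

lemma aux_closed {S : Type*} [MetricSpace S] [MeasurableSpace S] [BorelSpace S]
    (P : Measure S) [IsProbabilityMeasure P] (Qs : ℕ → ProbabilityMeasure S)
    (Q : ProbabilityMeasure S)  (F : ℝ → ℝ≥0∞) (y g : ℕ → ℝ) (hy0 : y 0 = 0) (hg0 : g 0 = 0)
    (hF : ∀ x, F x = ⨆ n, ENNReal.ofReal (x * y n - g n)) (C : ℝ) (hC : 0 ≤ C)
    (hset : ∀ A, MeasurableSet A →
      Tendsto (fun n => (Qs n : Measure S) A) atTop (𝓝 ((Q : Measure S) A)))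
    (hac : ∀ n, (Qs n : Measure S) ≪ P)
    (hint : ∀ n, ∫⁻ x, F ((Qs n : Measure S).rnDeriv P x).toReal ∂P ≤ ENNReal.ofReal C) :
    (Q : Measure S) ≪ P ∧
      ∫⁻ x, F ((Q : Measure S).rnDeriv P x).toReal ∂P ≤ ENNReal.ofReal C := by
  have hQ : (Q : Measure S) ≪ P := by
    refine Measure.AbsolutelyContinuous.mk fun A hA h0 => ?_
    have h1 := hset A hA
    have h2 : (fun n => (Qs n : Measure S) A) = fun _ => 0 := by
      funext n; exact hac n h0
    rw [h2] at h1
    exact tendsto_nhds_unique h1 tendsto_const_nhds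
  refine ⟨hQ, ?_⟩
  set q : S → ℝ := fun x => ((Q : Measure S).rnDeriv P x).toReal with hq
  have hqm : Measurable q := (Measure.measurable_rnDeriv _ _).ennreal_toReal
  let φ : ℕ → S → ℝ := fun n x => q x * y n - g n
  have hφ : ∀ n, Measurable (φ n) := fun n => (hqm.mul_const _).sub_const _
  have hsup : ∀ x, F (q x) = ⨆ k, ⨆ i ≤ k, ENNReal.ofReal (φ i x) := by
    intro x
    rw [hF]
    apply le_antisymm
    · exact iSup_le fun n => le_iSup_of_le n (le_iSup₂_of_le n le_rfl le_rfl)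
    · exact iSup_le fun k => iSup₂_le fun i _ => le_iSup (fun n => ENNReal.ofReal (φ n x)) i
  change ∫⁻ x, F (q x) ∂P ≤ _
  simp_rw [hsup]
  rw [lintegral_iSup]
  rotate_left
  · intro k
    exact Measurable.iSup fun i => Measurable.iSup fun _ => (hφ i).ennreal_ofReal
  · intro k l hkl x
    exact iSup₂_le fun i hi => le_iSup₂_of_le i (hi.trans hkl) le_rfl
  refine iSup_le fun k => ?_
  obtain ⟨N, hN, hNk, hmax⟩ := aux_argmax φ hφ k
  have hnn : ∀ x, 0 ≤ φ (N x) x := by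
    intro x
    have := hmax x 0 (Nat.zero_le _)
    simpa [φ, hy0, hg0] using this
  have hA := aux_affine P (Q : Measure S) hQ N hN k hNk y g
  calc ∫⁻ x, ⨆ i ≤ k, ENNReal.ofReal (φ i x) ∂P
      ≤ ∫⁻ x, ENNReal.ofReal (φ (N x) x) ∂P :=
        lintegral_mono fun x => iSup₂_le fun i hi => ENNReal.ofReal_le_ofReal (hmax x i hi)
    _ = ENNReal.ofReal (∫ x, φ (N x) x ∂P) :=
        (ofReal_integral_eq_lintegral_ofReal hA.1 (Eventually.of_forall hnn)).symm
    _ ≤ ENNReal.ofReal C := ?_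
  apply ENNReal.ofReal_le_ofReal
  change ∫ x, (((Q : Measure S).rnDeriv P x).toReal * y (N x) - g (N x)) ∂P ≤ C
  rw [hA.2]
  have hlim : Tendsto (fun n => ∫ x, y (N x) ∂(Qs n : Measure S) - ∫ x, g (N x) ∂P) atTop
      (𝓝 (∫ x, y (N x) ∂(Q : Measure S) - ∫ x, g (N x) ∂P)) := by
    refine Tendsto.sub_const ?_ _
    rw [(aux_int_sum (Q : Measure S) N hN k hNk y).2]
    simp_rw [fun n => (aux_int_sum (Qs n : Measure S) N hN k hNk y).2]
    refine tendsto_finsetSum _ fun i _ => Tendsto.mul_const _ ?_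
    exact (ENNReal.tendsto_toReal (measure_ne_top _ _)).comp
      (hset _ (hN (measurableSet_singleton i)))
  refine le_of_tendsto' hlim fun n => ?_
  have hB := aux_affine P (Qs n : Measure S) (hac n) N hN k hNk y g
  rw [← hB.2]
  refine (ENNReal.ofReal_le_ofReal_iff hC).1 ?_
  refine le_trans ?_ (hint n)
  refine (ENNReal.ofReal_le_ofReal (integral_mono hB.1 hB.1.real_toNNReal
    (fun x => le_max_left _ _))).trans ?_
  rw [ofReal_integral_eq_lintegral_ofReal hB.1.real_toNNReal
    (Eventually.of_forall fun x => le_max_right _ _)]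
  refine lintegral_mono fun x => ?_
  simp only [Real.coe_toNNReal', hF]
  rw [ENNReal.ofReal_max, ENNReal.ofReal_zero, max_eq_left zero_le]
  exact le_iSup (fun m => ENNReal.ofReal (((Qs n : Measure S).rnDeriv P x).toReal * y m - g m)) (N x)


/-- On a complete separable metric space, if `f*` is everywhere finite
then the sublevel sets `{Q : D_f(Q‖P) ≤ c}` are compact in the topology of weak
convergence of probability measures. -/
theorem stmt2 {S : Type*} [MetricSpace S] [CompleteSpace S] [TopologicalSpace.SeparableSpace S]
    [MeasurableSpace S] [BorelSpace S]
    (a b : EReal) (f : ℝ → EReal) (hf : IsF1 a b f)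
    (hfin : ∀ y : ℝ, fstar f y ≠ ⊤)
    (P : Measure S) [IsProbabilityMeasure P] (c : ℝ) :
    IsCompact {Q : ProbabilityMeasure S | fDivE f (Q : Measure S) P ≤ (c : EReal)} := by
  obtain ⟨M, y, g, hM, hy0, hg0, hb, hF, hG⟩ := aux_key hf hfin
  set F : ℝ → ℝ≥0∞ := fun x => posE (f x + (M : EReal)) with hFdef
  have hset : ∀ Q : ProbabilityMeasure S, fDivE f (Q : Measure S) P ≤ (c : EReal) ↔
      (Q : Measure S) ≪ P ∧ 0 ≤ c + M ∧
        ∫⁻ x, F ((Q : Measure S).rnDeriv P x).toReal ∂P ≤ ENNReal.ofReal (c + M) := by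
    intro Q
    unfold fDivE
    split_ifs with hac
    · simp only [hac, true_and]
      exact aux_eIntegral P _ (hf.lsc.measurable.comp
        (Measure.measurable_rnDeriv _ _).ennreal_toReal) M hM (fun x => hb _) c
    · simp [hac]
  simp only [hset]
  have huac := aux_uac P F hG (c + M)
  have : SecondCountableTopology S := UniformSpace.secondCountable_of_separable S
  set K := {Q : ProbabilityMeasure S | (Q : Measure S) ≪ P ∧ 0 ≤ c + M ∧
        ∫⁻ x, F ((Q : Measure S).rnDeriv P x).toReal ∂P ≤ ENNReal.ofReal (c + M)} with hK
  have hclosed : IsClosed K := by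
    apply IsSeqClosed.isClosed
    intro Qs Q hQs hlim
    have hC : 0 ≤ c + M := (hQs 0).2.1
    have h := aux_closed P Qs Q F y g hy0 hg0 hF (c + M) hC
      (aux_setwise P Qs Q hlim (fun ε hε => by
        obtain ⟨δ, hδ, h⟩ := huac ε hε
        exact ⟨δ, hδ, fun n A hA hPA =>
          h (Qs n) inferInstance (hQs n).1 (hQs n).2.2 A hA hPA⟩))
      (fun n => (hQs n).1) (fun n => (hQs n).2.2)
    exact ⟨h.1, hC, h.2⟩
  rw [← hclosed.closure_eq]
  apply isCompact_closure_of_isTightMeasureSet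
  rw [isTightMeasureSet_iff_exists_isCompact_measure_compl_le]
  intro ε hε
  obtain ⟨δ, hδ, h⟩ := huac ε hε
  obtain ⟨L, hL, hPL⟩ := isTightMeasureSet_iff_exists_isCompact_measure_compl_le.1
    (isTightMeasureSet_singleton (μ := P)) δ hδ
  refine ⟨L, hL, ?_⟩
  rintro _ ⟨Q, hQ, rfl⟩
  exact h Q inferInstance hQ.1 hQ.2.2 _ hL.measurableSet.compl (hPL P rfl)
end

section
/- Let f ∈ F₁(a,b) with a ≥ 0, let P be a probability measure on (Ω,M), and let g ∈ M_b(Ω). Then sup over probability measures Q on (Ω,M) with D_f(Q‖P) < ∞ of {E_Q[g] − D_f(Q‖P)} equals Λ_f^P[g] = inf_{ν∈ℝ}{ν + E_P[f*(g−ν)]} (the Gibbs variational formula for f-divergences). -/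
open MeasureTheory Filter Set Topology ENNReal
open scoped Classical

lemma sep_aux (S : Set (ℝ × ℝ)) (M : ℝ)
    (h1 : ∃ p ∈ S, p.1 < 1) (h2 : ∃ p ∈ S, 1 < p.1)
    (h0 : ∀ p ∈ S, p.1 = 1 → p.2 ≤ M)
    (H : ∀ p ∈ S, ∀ q ∈ S, ∀ t : ℝ, 0 < t → t < 1 → t * p.1 + (1 - t) * q.1 = 1 →
      t * p.2 + (1 - t) * q.2 ≤ M) :
    ∃ ν : ℝ, ∀ p ∈ S, p.2 ≤ M + ν * (p.1 - 1) := by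
  set A : Set ℝ := {x | ∃ p ∈ S, 1 < p.1 ∧ x = (p.2 - M) / (p.1 - 1)}
  set B : Set ℝ := {x | ∃ p ∈ S, p.1 < 1 ∧ x = (M - p.2) / (1 - p.1)}
  have hA : A.Nonempty := by
    obtain ⟨p, hp, h⟩ := h2
    exact ⟨_, p, hp, h, rfl⟩
  have hB : B.Nonempty := by
    obtain ⟨p, hp, h⟩ := h1
    exact ⟨_, p, hp, h, rfl⟩
  have hAB : ∀ x ∈ A, ∀ y ∈ B, x ≤ y := by
    rintro x ⟨q, hq, hq1, rfl⟩ y ⟨p, hp, hp1, rfl⟩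
    rw [div_le_div_iff₀ (by linarith) (by linarith)]
    have hd : 0 < q.1 - p.1 := by linarith
    have := H p hp q hq ((q.1 - 1) / (q.1 - p.1)) (div_pos (by linarith) hd)
      (by rw [div_lt_one hd]; linarith) (by field_simp; ring)
    have e : 1 - (q.1 - 1) / (q.1 - p.1) = (1 - p.1) / (q.1 - p.1) := by field_simp; ring
    rw [e, div_mul_eq_mul_div, div_mul_eq_mul_div, ← add_div, div_le_iff₀ hd] at this
    nlinarith
  obtain ⟨ν, hν⟩ : ∃ ν, (∀ x ∈ A, x ≤ ν) ∧ ∀ y ∈ B, ν ≤ y :=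
    ⟨sSup A, fun x hx => le_csSup ⟨hB.some, fun x hx => hAB x hx _ hB.some_mem⟩ hx,
      fun y hy => csSup_le hA fun x hx => hAB x hx y hy⟩
  refine ⟨ν, fun p hp => ?_⟩
  rcases lt_trichotomy p.1 1 with h | h | h
  · have := hν.2 _ ⟨p, hp, h, rfl⟩
    rw [le_div_iff₀ (by linarith)] at this
    nlinarith
  · have := h0 p hp h
    rw [h]; linarith
  · have := hν.1 _ ⟨p, hp, h, rfl⟩
    rw [div_le_iff₀ (by linarith)] at this
    nlinarith

lemma posE_mono : Monotone posE := by
  intro x y h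
  unfold posE
  split_ifs with h1 h2 h2
  · exact le_rfl
  · exact absurd (top_le_iff.1 (h1 ▸ h)) h2
  · exact le_top
  · by_cases hx : x = ⊥
    · simp [hx]
    · exact ENNReal.ofReal_le_ofReal (EReal.toReal_le_toReal h hx h2)

lemma posE_coe (x : ℝ) : posE (x : EReal) = ENNReal.ofReal x := by
  simp [posE]

lemma eInt_mono {Ω : Type*} [MeasurableSpace Ω] {P : Measure Ω} {h k : Ω → EReal}
    (hk : ∀ᵐ x ∂P, h x ≤ k x) : eIntegral P h ≤ eIntegral P k := by
  unfold eIntegral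
  apply EReal.sub_le_sub
  · exact EReal.coe_ennreal_le_coe_ennreal_iff.2
      (lintegral_mono_ae (hk.mono fun x hx => posE_mono hx))
  · exact EReal.coe_ennreal_le_coe_ennreal_iff.2
      (lintegral_mono_ae (hk.mono fun x hx => posE_mono (EReal.neg_le_neg_iff.2 hx)))

lemma eInt_coe {Ω : Type*} [MeasurableSpace Ω] {P : Measure Ω} {u : Ω → ℝ}
    (hu : Integrable u P) : eIntegral P (fun x => (u x : EReal)) = ((∫ x, u x ∂P : ℝ) : EReal) := by
  unfold eIntegral
  simp only [← EReal.coe_neg, posE_coe]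
  rw [integral_eq_lintegral_pos_part_sub_lintegral_neg_part hu, EReal.coe_sub]
  have h1 : (∫⁻ x, ENNReal.ofReal (u x) ∂P) ≠ ⊤ := hu.lintegral_lt_top.ne
  have h2 : (∫⁻ x, ENNReal.ofReal (-u x) ∂P) ≠ ⊤ := hu.neg.lintegral_lt_top.ne
  rw [EReal.coe_ennreal_toReal h1, EReal.coe_ennreal_toReal h2]

lemma eInt_congr {Ω : Type*} [MeasurableSpace Ω] {P : Measure Ω} {h k : Ω → EReal}
    (hk : ∀ᵐ x ∂P, h x = k x) : eIntegral P h = eIntegral P k :=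
  le_antisymm (eInt_mono (hk.mono fun _ h => h.le)) (eInt_mono (hk.mono fun _ h => h.ge))

lemma eInt_finite {Ω : Type*} [MeasurableSpace Ω] {P : Measure Ω} {h : Ω → EReal} {u : Ω → ℝ}
    (hm : Measurable h) (hu : Integrable u P) (hle : ∀ᵐ x ∂P, (u x : EReal) ≤ h x)
    (hfin : eIntegral P h < ⊤) :
    Integrable (fun x => (h x).toReal) P ∧ ∀ᵐ x ∂P, h x = ((h x).toReal : EReal) := by
  have hpm : Measurable (fun x => posE (h x)) := posE_mono.measurable.comp hm
  have hB : (∫⁻ x, posE (-(h x)) ∂P) ≠ ⊤ := by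
    refine ne_top_of_le_ne_top hu.neg.lintegral_lt_top.ne (lintegral_mono_ae ?_)
    filter_upwards [hle] with x hx
    have := posE_mono (EReal.neg_le_neg_iff.2 hx)
    rwa [← EReal.coe_neg, posE_coe] at this
  have hA : (∫⁻ x, posE (h x) ∂P) ≠ ⊤ := by
    intro hA
    unfold eIntegral at hfin
    rw [hA, ← EReal.coe_ennreal_toReal hB] at hfin
    simp at hfin
  have hae : ∀ᵐ x ∂P, h x = ((h x).toReal : EReal) := by
    filter_upwards [ae_lt_top hpm hA, hle] with x hx hx2
    refine (EReal.coe_toReal ?_ ?_).symm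
    · intro h0; simp [posE, h0] at hx
    · intro h0; simp [h0] at hx2
  refine ⟨⟨hm.ereal_toReal.aestronglyMeasurable, ?_⟩, hae⟩
  rw [hasFiniteIntegral_iff_norm]
  refine lt_of_le_of_lt (lintegral_mono_ae (g := fun x => posE (h x) + posE (-(h x))) ?_) ?_
  · filter_upwards [hae] with x hx
    rw [hx]
    simp only [← EReal.coe_neg, posE_coe, EReal.toReal_coe]
    rw [Real.norm_eq_abs]
    rcases abs_cases (h x).toReal with ⟨h1, _⟩ | ⟨h1, _⟩ <;> rw [h1]
    · exact le_self_add
    · exact le_add_self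
  · rw [lintegral_add_left hpm]
    exact ENNReal.add_lt_top.2 ⟨hA.lt_top, hB.lt_top⟩

lemma eInt_sup_le {Ω : Type*} [MeasurableSpace Ω] {P : Measure Ω} {h : Ω → EReal}
    (u : ℕ → Ω → ℝ) (hum : ∀ n, Measurable (u n)) (hu : ∀ n, Integrable (u n) P)
    (hmono : ∀ x, Monotone fun n => u n x)
    (K : ℝ) (hK : ∀ n, ∫ x, u n x ∂P ≤ K)
    (hh : ∀ x (v : ℝ), (∀ n, u n x ≤ v) → h x ≤ v) : eIntegral P h ≤ (K : EReal) := by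
  set D : Ω → ℝ≥0∞ := fun x => ⨆ n, ENNReal.ofReal (u n x - u 0 x) with hD
  have hmD : ∀ n, Measurable fun x => ENNReal.ofReal (u n x - u 0 x) :=
    fun n => ((hum n).sub (hum 0)).ennreal_ofReal
  have hDm : Measurable D := Measurable.iSup hmD
  have hDi : ∫⁻ x, D x ∂P ≤ ENNReal.ofReal (K - ∫ x, u 0 x ∂P) := by
    rw [hD, lintegral_iSup hmD]
    · refine iSup_le fun n => ?_
      rw [← ofReal_integral_eq_lintegral_ofReal (f := fun x => u n x - u 0 x) ((hu n).sub (hu 0))]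
      · rw [integral_sub (hu n) (hu 0)]
        exact ENNReal.ofReal_le_ofReal (by linarith [hK n])
      · exact Eventually.of_forall fun x => sub_nonneg.2 (hmono x (Nat.zero_le n))
    · intro n m hnm x
      exact ENNReal.ofReal_le_ofReal (by linarith [hmono x hnm])
  have hDt : ∫⁻ x, D x ∂P ≠ ⊤ := ne_top_of_le_ne_top ENNReal.ofReal_ne_top hDi
  have hint : Integrable (fun x => (D x).toReal) P := integrable_toReal_of_lintegral_ne_top hDm.aemeasurable hDt
  calc eIntegral P h ≤ eIntegral P (fun x => ((u 0 x + (D x).toReal : ℝ) : EReal)) := by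
        apply eInt_mono
        filter_upwards [ae_lt_top hDm hDt] with x hx
        refine hh x _ fun n => ?_
        have : ENNReal.ofReal (u n x - u 0 x) ≤ D x := le_iSup (fun n => ENNReal.ofReal (u n x - u 0 x)) n
        have := (ENNReal.ofReal_le_iff_le_toReal hx.ne).1 this
        linarith
    _ = ((∫ x, (u 0 x + (D x).toReal) ∂P : ℝ) : EReal) := eInt_coe ((hu 0).add hint)
    _ ≤ (K : EReal) := by
        rw [EReal.coe_le_coe_iff, integral_add (hu 0) hint,
          integral_toReal hDm.aemeasurable (ae_lt_top hDm hDt)]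
        have := ENNReal.toReal_mono ENNReal.ofReal_ne_top hDi
        rw [ENNReal.toReal_ofReal (by linarith [hK 0])] at this
        linarith

lemma f_coe {a b : EReal} {f : ℝ → EReal} (hf : IsF1 a b f) {x : ℝ} (hx : f x ≠ ⊤) :
    f x = ((f x).toReal : EReal) := (EReal.coe_toReal hx (hf.ne_bot x)).symm

lemma f_conv {a b : EReal} {f : ℝ → EReal} (hf : IsF1 a b f) {x y t : ℝ} (hx : f x ≠ ⊤)
    (hy : f y ≠ ⊤) (h0 : 0 < t) (h1 : t < 1) :
    f (t * x + (1 - t) * y) ≠ ⊤ ∧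
    (f (t * x + (1 - t) * y)).toReal ≤ t * (f x).toReal + (1 - t) * (f y).toReal := by
  have h := hf.convex x y t h0 h1
  rw [f_coe hf hx, f_coe hf hy, ← EReal.coe_mul, ← EReal.coe_mul, ← EReal.coe_add] at h
  have hne : f (t * x + (1 - t) * y) ≠ ⊤ := fun h' => by
    rw [h'] at h
    exact EReal.coe_ne_top _ (top_le_iff.1 h)
  refine ⟨hne, ?_⟩
  rw [f_coe hf hne] at h
  exact EReal.coe_le_coe_iff.1 h

lemma f_left {a b : EReal} {f : ℝ → EReal} (hf : IsF1 a b f) : ∃ x < 1, f x ≠ ⊤ := by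
  obtain ⟨x, h1, h2⟩ := EReal.lt_iff_exists_real_btwn.1 hf.a_lt_one
  exact ⟨x, EReal.coe_lt_coe_iff.1 h2, hf.finite_on x h1 (h2.trans hf.one_lt_b)⟩

lemma f_right {a b : EReal} {f : ℝ → EReal} (hf : IsF1 a b f) : ∃ x > 1, f x ≠ ⊤ := by
  obtain ⟨x, h1, h2⟩ := EReal.lt_iff_exists_real_btwn.1 hf.one_lt_b
  exact ⟨x, EReal.coe_lt_coe_iff.1 h1, hf.finite_on x (hf.a_lt_one.trans h1) h2⟩

lemma f_subgrad {a b : EReal} {f : ℝ → EReal} (hf : IsF1 a b f) :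
    ∃ c : ℝ, ∀ x : ℝ, ((c * (x - 1) : ℝ) : EReal) ≤ f x := by
  obtain ⟨ν, hν⟩ := sep_aux {p | f p.1 ≠ ⊤ ∧ p.2 = -(f p.1).toReal} 0
    (by obtain ⟨x, hx, h⟩ := f_left hf; exact ⟨(x, -(f x).toReal), ⟨h, rfl⟩, hx⟩)
    (by obtain ⟨x, hx, h⟩ := f_right hf; exact ⟨(x, -(f x).toReal), ⟨h, rfl⟩, hx⟩)
    (by rintro ⟨x, v⟩ ⟨h, h'⟩ (rfl : x = 1)
        simp [hf.at_one] at h'; simp [h'])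
    (by rintro ⟨x, v⟩ ⟨h, h'⟩ ⟨y, w⟩ ⟨k, k'⟩ t t0 t1 e
        simp only at *
        have := (f_conv hf h k t0 t1).2
        rw [e, hf.at_one, EReal.toReal_zero] at this
        rw [h', k']; linarith)
  refine ⟨-ν, fun x => ?_⟩
  by_cases hx : f x = ⊤
  · simp [hx]
  · have := hν (x, -(f x).toReal) ⟨hx, rfl⟩
    rw [f_coe hf hx, EReal.coe_le_coe_iff]
    simp only at this
    linarith

lemma f_nonneg {a b : EReal} {f : ℝ → EReal} (hf : IsF1 a b f) (ha : (0 : EReal) ≤ a) {x : ℝ}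
    (hx : f x ≠ ⊤) : 0 ≤ x := by
  by_contra h
  push Not at h
  exact hx (hf.top_outside x (Or.inl (lt_of_lt_of_le (by exact_mod_cast h) ha)))

lemma bdd_mul_int {Ω : Type*} [MeasurableSpace Ω] {P : Measure Ω} {g u : Ω → ℝ} (hg : g ∈ Mb Ω)
    (hu : Integrable u P) : Integrable (fun x => u x * g x) P := by
  obtain ⟨hm, C, hC⟩ := hg
  exact hu.mul_bdd hm.aestronglyMeasurable (Eventually.of_forall hC)

lemma weak_dual {Ω : Type*} [MeasurableSpace Ω] (a b : EReal) (f : ℝ → EReal)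
    (hf : IsF1 a b f)
    (P : Measure Ω) [IsProbabilityMeasure P] (g : Ω → ℝ) (hg : g ∈ Mb Ω)
    (Q : Measure Ω) [IsProbabilityMeasure Q] (hQ : fDivE f Q P < ⊤) (ν : ℝ) :
    ((∫ x, g x ∂Q : ℝ) : EReal) - fDivE f Q P
      ≤ (ν : EReal) + eIntegral P (fun x => fstar f (g x - ν)) := by
  have hac : Q ≪ P := by
    by_contra h
    simp [fDivE, h] at hQ
  simp only [fDivE, hac, if_true] at hQ ⊢
  obtain ⟨c, hc⟩ := f_subgrad hf
  set r : Ω → ℝ := fun x => (Q.rnDeriv P x).toReal with hr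
  have hrm : Measurable r := (Measure.measurable_rnDeriv Q P).ennreal_toReal
  have hri : Integrable r P := Measure.integrable_toReal_rnDeriv
  obtain ⟨hwi, hw⟩ := eInt_finite (P := P) (h := fun x => f (r x)) (u := fun x => c * (r x - 1))
    (hf.lsc.measurable.comp hrm) ((hri.sub (integrable_const 1)).const_mul c)
    (Eventually.of_forall fun x => hc _) hQ
  change _ - eIntegral P (fun x => f (r x)) ≤ _
  rw [eInt_congr hw, eInt_coe hwi]
  have hrg := bdd_mul_int hg hri
  have e1 : ∫ x, g x ∂Q = ∫ x, r x * g x ∂P := (integral_rnDeriv_smul hac).symm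
  have e2 : ∫ x, r x ∂P = 1 := by
    rw [hr, Measure.integral_toReal_rnDeriv hac]; simp
  have hint : Integrable (fun x => r x * g x - ν * r x - (f (r x)).toReal) P :=
    (hrg.sub (hri.const_mul ν)).sub hwi
  have key : ((∫ x, (r x * g x - ν * r x - (f (r x)).toReal) ∂P : ℝ) : EReal)
      ≤ eIntegral P (fun x => fstar f (g x - ν)) := by
    rw [← eInt_coe hint]
    apply eInt_mono
    filter_upwards [hw] with x hx
    refine le_trans ?_ (le_iSup (fun z : ℝ => ((z * (g x - ν) : ℝ) : EReal) - f z) (r x))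
    rw [hx, ← EReal.coe_sub, EReal.coe_le_coe_iff, EReal.toReal_coe]
    linarith
  refine le_trans ?_ (add_le_add_right key (ν : EReal))
  rw [← EReal.coe_sub, ← EReal.coe_add, EReal.coe_le_coe_iff]
  rw [integral_sub (f := fun x => r x * g x - ν * r x) (hrg.sub (hri.const_mul ν)) hwi,
    integral_sub hrg (hri.const_mul ν),
    integral_const_mul, e1, e2]
  linarith

/-- value function -/
noncomputable def Jv {Ω : Type*} [MeasurableSpace Ω] (f : ℝ → EReal) (P : Measure Ω) (g : Ω → ℝ)
    (r : SimpleFunc Ω ℝ) : ℝ := ∫ x, (r x * g x - (f (r x)).toReal) ∂P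

lemma phi_int {Ω : Type*} [MeasurableSpace Ω] (f : ℝ → EReal) (P : Measure Ω)
    [IsProbabilityMeasure P] (r : SimpleFunc Ω ℝ) : Integrable (fun x => (f (r x)).toReal) P :=
  (r.map fun x => (f x).toReal).integrable_of_isFiniteMeasure

lemma J_attained {Ω : Type*} [MeasurableSpace Ω] (a b : EReal) (f : ℝ → EReal)
    (hf : IsF1 a b f) (ha : (0 : EReal) ≤ a)
    (P : Measure Ω) [IsProbabilityMeasure P] (g : Ω → ℝ) (hg : g ∈ Mb Ω)
    (r : SimpleFunc Ω ℝ) (hr : ∀ x, f (r x) ≠ ⊤) (h1 : ∫ x, r x ∂P = 1) :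
    ∃ Q : Measure Ω, (IsProbabilityMeasure Q ∧ fDivE f Q P < ⊤) ∧
      ((∫ x, g x ∂Q : ℝ) : EReal) - fDivE f Q P = (Jv f P g r : EReal) := by
  have hri : Integrable r P := r.integrable_of_isFiniteMeasure
  have hr0 : ∀ x, 0 ≤ r x := fun x => f_nonneg hf ha (hr x)
  have hdm : Measurable fun x => ENNReal.ofReal (r x) := r.measurable.ennreal_ofReal
  set Q := P.withDensity (fun x => ENNReal.ofReal (r x)) with hQ
  have hQp : IsProbabilityMeasure Q := by
    constructor
    rw [hQ, withDensity_apply _ MeasurableSet.univ, Measure.restrict_univ,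
      ← ofReal_integral_eq_lintegral_ofReal hri (Eventually.of_forall hr0), h1, ENNReal.ofReal_one]
  have hac : Q ≪ P := withDensity_absolutelyContinuous _ _
  have hrn : ∀ᵐ x ∂P, (Q.rnDeriv P x).toReal = r x := by
    filter_upwards [Measure.rnDeriv_withDensity P hdm] with x hx
    rw [hQ, hx, ENNReal.toReal_ofReal (hr0 x)]
  have hD : fDivE f Q P = ((∫ x, (f (r x)).toReal ∂P : ℝ) : EReal) := by
    simp only [fDivE, hac, if_true]
    rw [← eInt_coe (phi_int f P r)]
    apply eInt_congr
    filter_upwards [hrn] with x hx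
    rw [hx]; exact f_coe hf (hr x)
  refine ⟨Q, ⟨hQp, hD ▸ EReal.coe_lt_top _⟩, ?_⟩
  have e1 : ∫ x, g x ∂Q = ∫ x, r x * g x ∂P := by
    rw [← integral_rnDeriv_smul hac]
    apply integral_congr_ae
    filter_upwards [hrn] with x hx
    simp [hx]
  rw [hD, e1, ← EReal.coe_sub, Jv, integral_sub (bdd_mul_int hg hri) (phi_int f P r)]

lemma exists_seq {a b : EReal} {f : ℝ → EReal} (hf : IsF1 a b f) :
    ∃ q : ℕ → ℝ, (∀ n, f (q n) ≠ ⊤) ∧ ∀ y v : ℝ, (∀ n, q n * y - (f (q n)).toReal ≤ v) →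
      fstar f y ≤ v := by
  let T := {p : ℝ × ℝ // f p.1 = (p.2 : EReal)}
  haveI : Nonempty T := ⟨⟨(1, 0), by simp [hf.at_one]⟩⟩
  let s := TopologicalSpace.denseSeq T
  refine ⟨fun n => (s n).1.1, fun n => by rw [(s n).2]; simp, fun y v h => ?_⟩
  refine iSup_le fun x => ?_
  by_cases hx : f x = ⊤
  · simp [hx]
  · have key : ∀ p : T, p.1.1 * y - p.1.2 ≤ v := by
      intro p
      refine (TopologicalSpace.denseRange_denseSeq T).induction_on (p := fun p : T => p.1.1 * y - p.1.2 ≤ v) p ?_ ?_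
      · exact isClosed_le (by fun_prop) (by fun_prop)
      · intro n
        have := h n
        rw [(s n).2, EReal.toReal_coe] at this
        exact this
    have := key ⟨(x, (f x).toReal), f_coe hf hx⟩
    rw [f_coe hf hx, ← EReal.coe_sub, EReal.coe_le_coe_iff]
    exact this

lemma exists_sel {Ω : Type*} [MeasurableSpace Ω] (f : ℝ → EReal) (g : Ω → ℝ) (hg : Measurable g)
    (q : ℕ → ℝ) (hq : ∀ n, f (q n) ≠ ⊤) :
    ∃ r : ℕ → SimpleFunc Ω ℝ, (∀ n x, f (r n x) ≠ ⊤) ∧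
      (∀ x, Monotone fun n => r n x * g x - (f (r n x)).toReal) ∧
      ∀ n x, q n * g x - (f (q n)).toReal ≤ r n x * g x - (f (r n x)).toReal := by
  have hset : ∀ (n : ℕ) (r : SimpleFunc Ω ℝ), MeasurableSet
      {x | r x * g x - (f (r x)).toReal ≤ q n * g x - (f (q n)).toReal} := fun n r =>
    measurableSet_le ((r.measurable.mul hg).sub (r.map fun x => (f x).toReal).measurable)
      ((hg.const_mul _).sub_const _)
  let r : ℕ → SimpleFunc Ω ℝ := fun n => Nat.rec (SimpleFunc.const Ω (q 0))
    (fun n r => SimpleFunc.piecewise _ (hset (n + 1) r) (SimpleFunc.const Ω (q (n + 1))) r) n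
  have hs : ∀ n x, r (n + 1) x =
      if r n x * g x - (f (r n x)).toReal ≤ q (n + 1) * g x - (f (q (n + 1))).toReal
      then q (n + 1) else r n x := by
    intro n x
    change (SimpleFunc.piecewise _ (hset (n + 1) (r n)) (SimpleFunc.const Ω (q (n + 1))) (r n)) x = _
    rw [SimpleFunc.piecewise_apply]
    rfl
  refine ⟨r, ?_, ?_, ?_⟩
  · intro n x
    induction n with
    | zero => exact hq 0
    | succ n ih => rw [hs]; split_ifs; exacts [hq _, ih]
  · intro x
    refine monotone_nat_of_le_succ fun n => ?_
    rw [hs]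
    split_ifs with h
    · exact h
    · exact le_rfl
  · intro n x
    cases n with
    | zero => exact le_rfl
    | succ n =>
      rw [hs]; split_ifs with h
      · exact le_rfl
      · exact (not_le.1 h).le

lemma strong_dual {Ω : Type*} [MeasurableSpace Ω] (a b : EReal) (f : ℝ → EReal)
    (hf : IsF1 a b f)
    (P : Measure Ω) [IsProbabilityMeasure P] (g : Ω → ℝ) (hg : g ∈ Mb Ω) (M : ℝ)
    (hM : ∀ r : SimpleFunc Ω ℝ, (∀ x, f (r x) ≠ ⊤) → ∫ x, r x ∂P = 1 → Jv f P g r ≤ M) :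
    LambdaF f P g ≤ M := by
  have hri : ∀ r : SimpleFunc Ω ℝ, Integrable r P := fun r => r.integrable_of_isFiniteMeasure
  have hJi : ∀ r : SimpleFunc Ω ℝ, Integrable (fun x => r x * g x - (f (r x)).toReal) P :=
    fun r => (bdd_mul_int hg (hri r)).sub (phi_int f P r)
  obtain ⟨ν, hν⟩ := sep_aux {p | ∃ r : SimpleFunc Ω ℝ, (∀ x, f (r x) ≠ ⊤) ∧
      p = (∫ x, r x ∂P, Jv f P g r)} M
    (by obtain ⟨x, hx, h⟩ := f_left hf
        exact ⟨_, ⟨SimpleFunc.const Ω x, fun _ => h, rfl⟩, by simpa using hx⟩)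
    (by obtain ⟨x, hx, h⟩ := f_right hf
        exact ⟨_, ⟨SimpleFunc.const Ω x, fun _ => h, rfl⟩, by simpa using hx⟩)
    (by rintro _ ⟨r, hr, rfl⟩ h
        exact hM r hr h)
    (by rintro _ ⟨r, hr, rfl⟩ _ ⟨s, hs, rfl⟩ t t0 t1 e
        simp only at *
        have ea : ∀ x, (t • r + (1 - t) • s : SimpleFunc Ω ℝ) x = t * r x + (1 - t) * s x :=
          fun x => by simp
        have := hM (t • r + (1 - t) • s)
          (fun x => by rw [ea]; exact (f_conv hf (hr x) (hs x) t0 t1).1)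
          (by simp only [ea]
              rw [integral_add ((hri r).const_mul t) ((hri s).const_mul (1 - t)),
                integral_const_mul, integral_const_mul, e])
        refine le_trans ?_ this
        unfold Jv
        rw [← integral_const_mul, ← integral_const_mul,
          ← integral_add ((hJi r).const_mul t) ((hJi s).const_mul (1 - t))]
        refine integral_mono (((hJi r).const_mul t).add ((hJi s).const_mul (1 - t))) (hJi _) ?_
        intro x
        simp only [ea]
        have := (f_conv hf (hr x) (hs x) t0 t1).2
        linarith)
  have hgν : Measurable fun x => g x - ν := hg.1.sub_const ν
  obtain ⟨q, hq, hq2⟩ := exists_seq hf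
  obtain ⟨r, hr, hmono, hge⟩ := exists_sel f (fun x => g x - ν) hgν q hq
  refine (iInf_le _ ν).trans ?_
  have hi : ∀ n, Integrable (fun x => r n x * (g x - ν) - (f (r n x)).toReal) P := by
    intro n
    refine ((hJi (r n)).sub ((hri (r n)).const_mul ν)).congr (Eventually.of_forall fun x => ?_)
    simp; ring
  have key : eIntegral P (fun x => fstar f (g x - ν)) ≤ ((M - ν : ℝ) : EReal) := by
    refine eInt_sup_le (fun n x => r n x * (g x - ν) - (f (r n x)).toReal) ?_ hi hmono _ ?_ ?_
    · intro n
      exact ((r n).measurable.mul hgν).sub ((r n).map fun x => (f x).toReal).measurable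
    · intro n
      have h1 := hν _ ⟨r n, hr n, rfl⟩
      have h2 : ∫ x, (r n x * (g x - ν) - (f (r n x)).toReal) ∂P
          = Jv f P g (r n) - ν * ∫ x, r n x ∂P := by
        rw [Jv, ← integral_const_mul, ← integral_sub (hJi (r n)) ((hri (r n)).const_mul ν)]
        congr 1; ext x; ring
      rw [h2]
      simp only at h1
      linarith
    · intro x v hv
      exact hq2 _ v fun n => (hge n x).trans (hv n)
  refine (add_le_add_right key (ν : EReal)).trans ?_
  rw [← EReal.coe_add, EReal.coe_le_coe_iff]
  linarith

/-- (Gibbs variational formula for `f`-divergences.) For `f ∈ F₁(a,b)`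
with `a ≥ 0`, `P` a probability measure and `g` bounded measurable,
`sup {E_Q[g] - D_f(Q‖P) : Q probability measure, D_f(Q‖P) < ∞} = Λ_f^P[g]`. -/
theorem stmt5 {Ω : Type*} [MeasurableSpace Ω] (a b : EReal) (f : ℝ → EReal)
    (hf : IsF1 a b f) (ha : (0 : EReal) ≤ a)
    (P : Measure Ω) [IsProbabilityMeasure P] (g : Ω → ℝ) (hg : g ∈ Mb Ω) :
    (⨆ Q ∈ {Q : Measure Ω | IsProbabilityMeasure Q ∧ fDivE f Q P < ⊤},
      (((∫ x, g x ∂Q : ℝ) : EReal) - fDivE f Q P))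
    = LambdaF f P g := by
  apply le_antisymm
  · refine iSup₂_le fun Q hQ => le_iInf fun ν => ?_
    haveI := hQ.1
    exact weak_dual a b f hf P g hg Q hQ.2 ν
  · set S := ⨆ Q ∈ {Q : Measure Ω | IsProbabilityMeasure Q ∧ fDivE f Q P < ⊤},
      (((∫ x, g x ∂Q : ℝ) : EReal) - fDivE f Q P) with hS
    have hle : ∀ r : SimpleFunc Ω ℝ, (∀ x, f (r x) ≠ ⊤) → ∫ x, r x ∂P = 1 →
        (Jv f P g r : EReal) ≤ S := by
      intro r hr h1
      obtain ⟨Q, hQ, e⟩ := J_attained a b f hf ha P g hg r hr h1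
      rw [← e]
      exact le_iSup₂ (f := fun (Q : Measure Ω)
        (_ : Q ∈ {Q : Measure Ω | IsProbabilityMeasure Q ∧ fDivE f Q P < ⊤}) =>
        (((∫ x, g x ∂Q : ℝ) : EReal) - fDivE f Q P)) Q hQ
    by_cases hT : S = ⊤
    · rw [hT]; exact le_top
    have hB : S ≠ ⊥ := by
      intro h
      have := hle (SimpleFunc.const Ω 1) (fun x => by simp [hf.at_one]) (by simp)
      rw [h] at this
      simp at this
    rw [← EReal.coe_toReal hT hB]
    refine strong_dual a b f hf P g hg _ fun r hr h1 => ?_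
    have := hle r hr h1
    rwa [← EReal.coe_toReal hT hB, EReal.coe_le_coe_iff] at this
end
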